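/- For α > 2 and T > 0, the integral ∫_{1}^{∞} (1 − 1/(1 + T u^{−α/2})²) du converges and equals ₂F₁(2, −2/α; 1 − 2/α; −T) − 1, where ₂F₁ is the Gauss hypergeometric function. Consequently, ∫_0^∞ exp(−π λ r² ₂F₁(2, −2/α; 1 − 2/α; −T)) · 2πλ r dr = 1 / ₂F₁(2, −2/α; 1 − 2/α; −T). -/

import Mathlib

open MeasureTheory Real Set

/-- The Gauss hypergeometric series `₂F₁(a,b;c;z) = ∑ (a)ₙ(b)ₙ/((c)ₙ n!) zⁿ`
(convergent for `|z| < 1`). -/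
noncomputable def gauss2F1series (a b c z : ℝ) : ℝ :=
  ∑' n : ℕ, ((ascPochhammer ℝ n).eval a * (ascPochhammer ℝ n).eval b /
    ((ascPochhammer ℝ n).eval c * (Nat.factorial n))) * z ^ n

/-- The Gauss hypergeometric function for `z ≤ 0`, defined by analytic
continuation of the series via the Pfaff transformation
`₂F₁(a,b;c;z) = (1−z)^{−a} ₂F₁(a, c−b; c; z/(z−1))`. -/
noncomputable def gauss2F1 (a b c z : ℝ) : ℝ :=
  (1 - z) ^ (-a) * gauss2F1series a (c - b) c (z / (z - 1))

open Filter Topology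

lemma summable_quadratic_mul_deriv_pow (K : ℝ) {r : ℝ} (hrn : ‖r‖ < 1) :
    Summable (fun n : ℕ => K * ((n : ℝ) + 1) ^ 2 * (n * r ^ (n - 1))) := by
  rw [← summable_nat_add_iff 1]
  have h := ((summable_pow_mul_geometric_of_norm_lt_one 3 hrn).add
    (((summable_pow_mul_geometric_of_norm_lt_one 2 hrn).mul_left 5).add
    (((summable_pow_mul_geometric_of_norm_lt_one 1 hrn).mul_left 8).add
    ((summable_pow_mul_geometric_of_norm_lt_one 0 hrn).mul_left 4)))).mul_left K
  refine h.congr fun n => ?_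
  push_cast [Nat.add_sub_cancel]
  ring

/-- A power series with coefficients of at most quadratic growth converges on `(-1, 1)`, as does
the series of its termwise derivatives, and it can be differentiated term by term. -/
lemma hasDerivAt_tsum_mul_pow_of_quadratic_bound {a : ℕ → ℝ} {K : ℝ}
    (ha : ∀ n, |a n| ≤ K * ((n : ℝ) + 1) ^ 2) {w : ℝ} (hw : |w| < 1) :
    Summable (fun n => a n * w ^ n) ∧ Summable (fun n : ℕ => a n * (n * w ^ (n - 1))) ∧
      HasDerivAt (fun z => ∑' n, a n * z ^ n) (∑' n : ℕ, a n * (n * w ^ (n - 1))) w := by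
  obtain ⟨r, hwr, hr1⟩ := exists_between hw
  have hr0 : 0 < r := (abs_nonneg w).trans_lt hwr
  have hrn : ‖r‖ < 1 := by rwa [Real.norm_of_nonneg hr0.le]
  have hK : 0 ≤ K := by simpa using (abs_nonneg _).trans (ha 0)
  have hbound := summable_quadratic_mul_deriv_pow K hrn
  have hle : ∀ (n : ℕ) (y : ℝ), |y| < r →
      ‖a n * (n * y ^ (n - 1))‖ ≤ K * ((n : ℝ) + 1) ^ 2 * (n * r ^ (n - 1)) := by
    intro n y hy
    rw [norm_mul, norm_mul, norm_pow, Real.norm_eq_abs, Real.norm_eq_abs, Real.norm_eq_abs,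
      Nat.abs_cast]
    gcongr
    exact ha n
  have hmem : ∀ y : ℝ, y ∈ Metric.ball (0 : ℝ) r → |y| < r := fun y hy => by
    simpa using hy
  have hwmem : w ∈ Metric.ball (0 : ℝ) r := by simpa using hwr
  have hder : ∀ (n : ℕ) (y : ℝ), y ∈ Metric.ball (0 : ℝ) r →
      HasDerivAt (fun z => a n * z ^ n) (a n * (n * y ^ (n - 1))) y := fun n y _ =>
    (hasDerivAt_pow n y).const_mul (a n)
  have hle' : ∀ (n : ℕ) (y : ℝ), y ∈ Metric.ball (0 : ℝ) r →
      ‖a n * (n * y ^ (n - 1))‖ ≤ K * ((n : ℝ) + 1) ^ 2 * (n * r ^ (n - 1)) :=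
    fun n y hy => hle n y (hmem y hy)
  have h0 : Summable (fun n => a n * (0 : ℝ) ^ n) :=
    summable_of_ne_finset_zero (s := {0}) fun n hn => by
      simp [Finset.mem_singleton.not.mp hn]
  have hpre : IsPreconnected (Metric.ball (0 : ℝ) r) := (convex_ball 0 r).isPreconnected
  have hzero : (0 : ℝ) ∈ Metric.ball (0 : ℝ) r := Metric.mem_ball_self hr0
  refine ⟨?_, ?_, ?_⟩
  · exact summable_of_summable_hasDerivAt_of_isPreconnected (g := fun n z => a n * z ^ n)
      hbound Metric.isOpen_ball hpre hder hle' hzero h0 hwmem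
  · exact .of_norm_bounded hbound fun n => hle n w hwr
  · exact hasDerivAt_tsum_of_isPreconnected (g := fun n z => a n * z ^ n)
      (g' := fun n y => a n * (n * y ^ (n - 1)))
      hbound Metric.isOpen_ball hpre hder hle' hzero h0 hwmem

/-- The coefficients of `₂F₁(2, 1; c; ·)`. -/
noncomputable def hypergeometricTwoOneCoeff (c : ℝ) (n : ℕ) : ℝ :=
  (ascPochhammer ℝ n).eval 2 * (ascPochhammer ℝ n).eval 1 /
    ((ascPochhammer ℝ n).eval c * (Nat.factorial n))

lemma hypergeometricTwoOneCoeff_zero (c : ℝ) : hypergeometricTwoOneCoeff c 0 = 1 := by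
  simp [hypergeometricTwoOneCoeff]

lemma hypergeometricTwoOneCoeff_nonneg {c : ℝ} (hc : 0 < c) (n : ℕ) :
    0 ≤ hypergeometricTwoOneCoeff c n := by
  have h1 := ascPochhammer_pos n (1 : ℝ) one_pos
  have h2 := ascPochhammer_pos n (2 : ℝ) two_pos
  have h3 := ascPochhammer_pos n c hc
  unfold hypergeometricTwoOneCoeff
  positivity

lemma hypergeometricTwoOneCoeff_succ {c : ℝ} (hc : 0 < c) (n : ℕ) :
    (n + c) * hypergeometricTwoOneCoeff c (n + 1) = (n + 2) * hypergeometricTwoOneCoeff c n := by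
  have h3 := (ascPochhammer_pos n c hc).ne'
  have h4 : c + n ≠ 0 := by positivity
  have h5 : (Nat.factorial n : ℝ) ≠ 0 := by positivity
  have h6 : (n : ℝ) + 1 ≠ 0 := by positivity
  simp only [hypergeometricTwoOneCoeff, ascPochhammer_succ_eval, Nat.factorial_succ, Nat.cast_mul,
    Nat.cast_add, Nat.cast_one]
  field_simp
  ring

lemma abs_hypergeometricTwoOneCoeff_le {c : ℝ} (hc : 0 < c) (hc1 : c ≤ 1) (n : ℕ) :
    |hypergeometricTwoOneCoeff c n| ≤ 1 / c * ((n : ℝ) + 1) ^ 2 := by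
  rw [abs_of_nonneg (hypergeometricTwoOneCoeff_nonneg hc n)]
  have key : ∀ m : ℕ, c * hypergeometricTwoOneCoeff c (m + 1) ≤ (m + 2) * (m + 1) := by
    intro m
    induction m with
    | zero =>
      have := hypergeometricTwoOneCoeff_succ hc 0
      simp [hypergeometricTwoOneCoeff_zero] at this ⊢
      exact this.le
    | succ m ih =>
      have h := hypergeometricTwoOneCoeff_succ hc (m + 1)
      have hn := hypergeometricTwoOneCoeff_nonneg hc (m + 1 + 1)
      push_cast at h ⊢
      have hm : (0 : ℝ) < m + 1 := by positivity
      have h' : (m + 1) * (c * hypergeometricTwoOneCoeff c (m + 1 + 1)) ≤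
          (m + 1) * ((m + 1 + 2) * (m + 1 + 1)) := by
        calc (m + 1) * (c * hypergeometricTwoOneCoeff c (m + 1 + 1))
            ≤ c * ((m + 1 + c) * hypergeometricTwoOneCoeff c (m + 1 + 1)) := by
              nlinarith [mul_nonneg (mul_nonneg hc.le hc.le) hn]
          _ = (m + 1 + 2) * (c * hypergeometricTwoOneCoeff c (m + 1)) := by rw [h]; ring
          _ ≤ (m + 1 + 2) * ((m + 2) * (m + 1)) := by gcongr
          _ = _ := by ring
      exact le_of_mul_le_mul_left h' hm
  rw [one_div, inv_mul_eq_div, le_div_iff₀ hc, mul_comm]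
  cases n with
  | zero => simpa [hypergeometricTwoOneCoeff_zero] using hc1
  | succ m =>
    refine (key m).trans ?_
    push_cast
    nlinarith [(Nat.cast_nonneg m : (0 : ℝ) ≤ m)]

lemma gauss2F1series_two_one_zero (c : ℝ) : gauss2F1series 2 1 c 0 = 1 := by
  unfold gauss2F1series
  rw [tsum_eq_single 0 fun n hn => by simp [hn]]
  simp

/-- The first-order differential equation satisfied by `₂F₁(2, 1; c; ·)`. -/
lemma exists_hasDerivAt_gauss2F1series_two_one {c : ℝ} (hc : 0 < c) (hc1 : c ≤ 1) {w : ℝ}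
    (hw : |w| < 1) :
    ∃ S' : ℝ, HasDerivAt (gauss2F1series 2 1 c) S' w ∧
      (1 - c + 2 * w) * gauss2F1series 2 1 c w - w * (1 - w) * S' = 1 - c := by
  obtain ⟨hs, hs', hd⟩ := hasDerivAt_tsum_mul_pow_of_quadratic_bound
    (abs_hypergeometricTwoOneCoeff_le hc hc1) hw
  refine ⟨_, hd, ?_⟩
  change (1 - c + 2 * w) * (∑' n, hypergeometricTwoOneCoeff c n * w ^ n) - _ = _
  set a := hypergeometricTwoOneCoeff c with ha
  set S := ∑' n, a n * w ^ n
  set S' := ∑' n : ℕ, a n * (n * w ^ (n - 1))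
  have hpow : ∀ n : ℕ, w * (n * w ^ (n - 1)) = n * w ^ n := by
    intro n
    cases n with
    | zero => simp
    | succ n => rw [Nat.add_sub_cancel]; ring
  have hlow : HasSum (fun n : ℕ => (1 - c - n) * (a n * w ^ n)) ((1 - c) * S - w * S') := by
    refine ((hs.hasSum.mul_left (1 - c)).sub (hs'.hasSum.mul_left w)).congr_fun ?_
    intro n
    linear_combination a n * hpow n
  have hhigh : HasSum (fun n : ℕ => (n + 2) * (a n * w ^ n) * w) ((2 * S + w * S') * w) := by
    refine (((hs.hasSum.mul_left 2).add (hs'.hasSum.mul_left w)).mul_right w).congr_fun ?_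
    intro n
    linear_combination (-a n * w) * hpow n
  have hshift := (hasSum_nat_add_iff' 1).mpr hlow
  have heq : (fun n : ℕ => (1 - c - ((n + 1 : ℕ) : ℝ)) * (a (n + 1) * w ^ (n + 1))) =
      fun n : ℕ => -((n + 2) * (a n * w ^ n) * w) := by
    funext n
    have h := hypergeometricTwoOneCoeff_succ hc n
    rw [← ha] at h
    push_cast
    linear_combination (-w ^ (n + 1)) * h
  rw [heq] at hshift
  have h := hshift.unique hhigh.neg
  simp only [Finset.sum_range_one, Nat.cast_zero, pow_zero, ha,
    hypergeometricTwoOneCoeff_zero] at h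
  linear_combination h

lemma gauss2F1_two_neg {δ t : ℝ} (ht : -1 < t) :
    gauss2F1 2 (-δ) (1 - δ) (-t) = ((1 + t) ^ 2)⁻¹ * gauss2F1series 2 1 (1 - δ) (t / (1 + t)) := by
  have h1 : -t / (-t - 1) = t / (1 + t) := by
    rw [← neg_div_neg_eq]; congr 1 <;> ring
  rw [gauss2F1, h1, sub_neg_eq_add, sub_neg_eq_add, sub_add_cancel, rpow_neg (by linarith),
    rpow_two]

/-- The first-order differential equation satisfied by `t ↦ ₂F₁(2, -δ; 1 - δ; -t)`. -/
lemma exists_hasDerivAt_gauss2F1_two_neg {δ t : ℝ} (hδ : 0 ≤ δ) (hδ1 : δ < 1) (ht : 0 ≤ t) :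
    ∃ F' : ℝ, HasDerivAt (fun s => gauss2F1 2 (-δ) (1 - δ) (-s)) F' t ∧
      t * F' = δ * (gauss2F1 2 (-δ) (1 - δ) (-t) - 1 / (1 + t) ^ 2) := by
  have ht1 : 0 < 1 + t := by positivity
  have hw : |t / (1 + t)| < 1 := by
    rw [abs_of_nonneg (by positivity), div_lt_one ht1]
    linarith
  obtain ⟨S', hS', hode⟩ := exists_hasDerivAt_gauss2F1series_two_one
    (sub_pos.mpr hδ1) (by linarith) hw
  have hadd : HasDerivAt (fun s : ℝ => 1 + s) 1 t := (hasDerivAt_id t).const_add 1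
  have harg := (hasDerivAt_id t).div hadd ht1.ne'
  have hF := ((hadd.pow 2).inv (pow_ne_zero 2 ht1.ne')).mul (hS'.comp t harg)
  have heq : (fun s => gauss2F1 2 (-δ) (1 - δ) (-s)) =ᶠ[nhds t]
      fun s => ((1 + s) ^ 2)⁻¹ * gauss2F1series 2 1 (1 - δ) (s / (1 + s)) := by
    filter_upwards [Ioi_mem_nhds (show (-1 : ℝ) < t by linarith)] with s hs
    exact gauss2F1_two_neg hs
  refine ⟨_, HasDerivAt.congr_of_eventuallyEq hF heq, ?_⟩
  rw [gauss2F1_two_neg (by linarith)]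
  simp only [Function.comp_apply, Pi.div_apply, Pi.pow_apply, Pi.inv_apply, id]
  generalize gauss2F1series 2 1 (1 - δ) (t / (1 + t)) = S at hode ⊢
  field_simp at hode ⊢
  linear_combination -hode

lemma gauss2F1_two_neg_zero (δ : ℝ) : gauss2F1 2 (-δ) (1 - δ) (-0) = 1 := by
  rw [gauss2F1_two_neg (by norm_num)]
  simp [gauss2F1series_two_one_zero]

lemma tendsto_mul_gauss2F1_sub_one {p T : ℝ} (hp : 1 < p) (hT : 0 < T) :
    Tendsto (fun x : ℝ => x * (gauss2F1 2 (-p⁻¹) (1 - p⁻¹) (-(T * x ^ (-p))) - 1)) atTop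
      (𝓝 0) := by
  have hp0 : 0 < p := by linarith
  obtain ⟨F', hF', -⟩ := exists_hasDerivAt_gauss2F1_two_neg (inv_nonneg.mpr hp0.le)
    (inv_lt_one_of_one_lt₀ hp) le_rfl
  have ht : Tendsto (fun x : ℝ => T * x ^ (-p)) atTop (𝓝[≠] 0) := by
    refine tendsto_nhdsWithin_iff.mpr ⟨?_, ?_⟩
    · simpa using (tendsto_rpow_neg_atTop hp0).const_mul T
    · filter_upwards [eventually_gt_atTop 0] with x hx
      exact (mul_pos hT (rpow_pos_of_pos hx _)).ne'
  have hslope := (hasDerivAt_iff_tendsto_slope.mp hF').comp ht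
  have hpow : Tendsto (fun x : ℝ => T * x ^ (-(p - 1))) atTop (𝓝 0) := by
    simpa using (tendsto_rpow_neg_atTop (sub_pos.mpr hp)).const_mul T
  have hlim := hslope.mul hpow
  rw [mul_zero] at hlim
  refine hlim.congr' ?_
  filter_upwards [eventually_gt_atTop 0] with x hx
  have hxp := (rpow_pos_of_pos hx (-p)).ne'
  have hsplit : x ^ (-(p - 1)) = x ^ (-p) * x := by
    rw [← rpow_add_one hx.ne']; congr 1; ring
  rw [Function.comp_apply, slope_def_field, gauss2F1_two_neg_zero, hsplit, sub_zero]
  field_simp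

/-- An antiderivative of `1 - 1 / (1 + T u ^ (-p)) ^ 2`. -/
lemma hasDerivAt_neg_mul_gauss2F1_sub_one {p T x : ℝ} (hp : 1 < p) (hT : 0 < T) (hx : 0 < x) :
    HasDerivAt (fun x : ℝ => -(x * (gauss2F1 2 (-p⁻¹) (1 - p⁻¹) (-(T * x ^ (-p))) - 1)))
      (1 - 1 / (1 + T * x ^ (-p)) ^ 2) x := by
  have hp0 : 0 < p := by linarith
  have hxp := rpow_pos_of_pos hx (-p)
  obtain ⟨F', hF', hode⟩ := exists_hasDerivAt_gauss2F1_two_neg (inv_nonneg.mpr hp0.le)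
    (inv_lt_one_of_one_lt₀ hp) (mul_pos hT hxp).le
  have ht : HasDerivAt (fun y : ℝ => T * y ^ (-p)) (T * (-p * x ^ (-p - 1))) x :=
    (hasDerivAt_rpow_const (Or.inl hx.ne')).const_mul T
  have h := ((hasDerivAt_id x).mul ((HasDerivAt.comp x hF' ht).sub_const 1)).neg
  refine h.congr_deriv ?_
  have hsplit : x ^ (-p) = x ^ (-p - 1) * x := by
    rw [← rpow_add_one hx.ne']; congr 1; ring
  have hode' : p * (T * x ^ (-p) * F') =
      gauss2F1 2 (-p⁻¹) (1 - p⁻¹) (-(T * x ^ (-p))) - 1 / (1 + T * x ^ (-p)) ^ 2 := by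
    rw [hode, mul_inv_cancel_left₀ hp0.ne']
  simp only [Function.comp_apply, id]
  linear_combination hode' - p * T * F' * hsplit

lemma one_sub_one_div_one_add_sq_nonneg {t : ℝ} (ht : 0 ≤ t) : 0 ≤ 1 - 1 / (1 + t) ^ 2 := by
  rw [sub_nonneg, div_le_one (by positivity)]
  nlinarith

lemma integrableOn_and_integral_eq_gauss2F1 {p T : ℝ} (hp : 1 < p) (hT : 0 < T) :
    IntegrableOn (fun u : ℝ => 1 - 1 / (1 + T * u ^ (-p)) ^ 2) (Ioi 1) ∧
    (∫ u in Ioi (1 : ℝ), (1 - 1 / (1 + T * u ^ (-p)) ^ 2)) =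
      gauss2F1 2 (-p⁻¹) (1 - p⁻¹) (-T) - 1 := by
  have hder : ∀ x ∈ Ici (1 : ℝ), HasDerivAt _ (1 - 1 / (1 + T * x ^ (-p)) ^ 2) x := fun x hx =>
    hasDerivAt_neg_mul_gauss2F1_sub_one hp hT (one_pos.trans_le hx)
  have hnonneg : ∀ x ∈ Ioi (1 : ℝ), 0 ≤ 1 - 1 / (1 + T * x ^ (-p)) ^ 2 := fun x hx =>
    one_sub_one_div_one_add_sq_nonneg
      (mul_pos hT (rpow_pos_of_pos (one_pos.trans hx) _)).le
  have hlim := (tendsto_mul_gauss2F1_sub_one hp hT).neg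
  refine ⟨integrableOn_Ioi_deriv_of_nonneg' hder hnonneg hlim, ?_⟩
  rw [integral_Ioi_of_hasDerivAt_of_nonneg' hder hnonneg hlim]
  simp

lemma integral_exp_neg_mul_sq_mul {b F : ℝ} (hb : 0 < b) (hF : 0 < F) :
    (∫ r in Ioi (0 : ℝ), Real.exp (-(b * r ^ 2 * F)) * (2 * b * r)) = 1 / F := by
  have hder : ∀ x ∈ Ici (0 : ℝ), HasDerivAt (fun r : ℝ => -Real.exp (-(b * r ^ 2 * F)) / F)
      (Real.exp (-(b * x ^ 2 * F)) * (2 * b * x)) x := by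
    intro x _
    have h := ((((hasDerivAt_pow 2 x).const_mul b).mul_const F).neg.exp.neg).div_const F
    refine h.congr_deriv ?_
    simp only [Pi.neg_apply]
    field_simp
    push_cast
    ring
  have hnonneg : ∀ x ∈ Ioi (0 : ℝ), 0 ≤ Real.exp (-(b * x ^ 2 * F)) * (2 * b * x) := by
    intro x hx
    have : 0 < x := hx
    positivity
  have hlim : Tendsto (fun r : ℝ => -Real.exp (-(b * r ^ 2 * F)) / F) atTop (𝓝 0) := by
    have hsq : Tendsto (fun r : ℝ => b * r ^ 2 * F) atTop atTop :=
      ((tendsto_pow_atTop two_ne_zero).const_mul_atTop hb).atTop_mul_const hF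
    simpa using ((tendsto_exp_neg_atTop_nhds_zero.comp hsq).neg).div_const F
  rw [integral_Ioi_of_hasDerivAt_of_nonneg' hder hnonneg hlim]
  simp [neg_div]

/-- For `α > 2`, `T > 0`: `∫₁^∞ (1 − 1/(1 + T u^{−α/2})²) du` converges and
equals `₂F₁(2, −2/α; 1 − 2/α; −T) − 1`; consequently
`∫₀^∞ exp(−πλr² ₂F₁(2,−2/α;1−2/α;−T)) 2πλr dr = 1/₂F₁(2,−2/α;1−2/α;−T)`. -/
theorem stmt_7 (α T lam : ℝ) (hα : 2 < α) (hT : 0 < T) (hlam : 0 < lam) :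
    IntegrableOn (fun u : ℝ => 1 - 1 / (1 + T * u ^ (-(α / 2))) ^ 2) (Ioi 1) ∧
    (∫ u in Ioi (1 : ℝ), (1 - 1 / (1 + T * u ^ (-(α / 2))) ^ 2)) =
      gauss2F1 2 (-(2 / α)) (1 - 2 / α) (-T) - 1 ∧
    (∫ r in Ioi (0 : ℝ),
        Real.exp (-(π * lam * r ^ 2 * gauss2F1 2 (-(2 / α)) (1 - 2 / α) (-T))) *
          (2 * π * lam * r)) =
      1 / gauss2F1 2 (-(2 / α)) (1 - 2 / α) (-T) := by
  have hp : 1 < α / 2 := by linarith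
  obtain ⟨hint, heq⟩ := integrableOn_and_integral_eq_gauss2F1 hp hT
  rw [inv_div] at heq
  have hF : 0 < gauss2F1 2 (-(2 / α)) (1 - 2 / α) (-T) := by
    have h : 0 ≤ ∫ u in Ioi (1 : ℝ), (1 - 1 / (1 + T * u ^ (-(α / 2))) ^ 2) :=
      setIntegral_nonneg measurableSet_Ioi fun u hu => one_sub_one_div_one_add_sq_nonneg
        (mul_pos hT (rpow_pos_of_pos (one_pos.trans hu) _)).le
    linarith
  refine ⟨hint, heq, ?_⟩
  rw [← integral_exp_neg_mul_sq_mul (mul_pos pi_pos hlam) hF]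
  simp only [mul_assoc]
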